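/- Let n ≥ 1 be an integer. If n is even, then the map Ψ_n sending η : E → ℂ to the pair (f,0) with f_e(x) = η_e·sin(nπx) is a linear isomorphism from the relative first homology H_1(X,∂V) := {η : E → ℂ | for every v ∈ V∖∂V, ∑_{e: t e = v} η_e = ∑_{e: s e = v} η_e} onto N₀^{∂V}(n²π²). If n is odd, the same map is a linear isomorphism from the relative unoriented first homology H̄_1(X,∂V) := {η : E → ℂ | for every v ∈ V∖∂V, ∑_{e: t e = v} η_e + ∑_{e: s e = v} η_e = 0} onto N₀^{∂V}(n²π²). -/

import Mathlib

open Finset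
open scoped Classical

variable {V E : Type*}

/-- The number of incidences of edges at the vertex `v` (a loop counts twice). -/
noncomputable def degE [Fintype E] [DecidableEq V] (s t : E → V) (v : V) : ℕ :=
  (univ.filter fun e => s e = v).card + (univ.filter fun e => t e = v).card

/-- The `λ`-eigenspace `N^{∂V}(λ)` of the Kirchhoff Laplacian of the equilateral
metric graph associated to `(V,E,s,t)` with Dirichlet conditions on `∂V`,
modelled as the set of pairs `(f,F)` of edge functions solving `f'' = −λ f` and
vertex values, subject to continuity, Dirichlet and Kirchhoff conditions. -/
noncomputable def metricEigenspace [Fintype E] [DecidableEq V] (s t : E → V)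
    (bd : Finset V) (lam : ℝ) : Set ((E → ℝ → ℂ) × (V → ℂ)) :=
  {p | (∀ e, ContDiff ℝ 2 (p.1 e)) ∧
    (∀ e x, deriv (deriv (p.1 e)) x = -(lam : ℂ) * p.1 e x) ∧
    (∀ e, p.1 e 0 = p.2 (s e)) ∧ (∀ e, p.1 e 1 = p.2 (t e)) ∧
    (∀ v ∈ bd, p.2 v = 0) ∧
    (∀ v, v ∉ bd →
      (∑ e ∈ univ.filter fun e => s e = v, deriv (p.1 e) 0) =
        ∑ e ∈ univ.filter fun e => t e = v, deriv (p.1 e) 1)}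

/-- The edge functions `η_e sin(μ x)` together with zero vertex values. -/
noncomputable def sinePair (μ : ℝ) (η : E → ℂ) : (E → ℝ → ℂ) × (V → ℂ) :=
  (fun e x => η e * ((Real.sin (μ * x) : ℝ) : ℂ), 0)

lemma hasDerivAt_ofReal_sin_mul (μ x : ℝ) :
    HasDerivAt (fun y : ℝ => ((Real.sin (μ * y) : ℝ) : ℂ))
      (((Real.cos (μ * x) : ℝ) : ℂ) * μ) x := by
  simpa using (((hasDerivAt_id x).const_mul μ).sin).ofReal_comp

lemma hasDerivAt_ofReal_cos_mul (μ x : ℝ) :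
    HasDerivAt (fun y : ℝ => ((Real.cos (μ * y) : ℝ) : ℂ))
      (-((Real.sin (μ * x) : ℝ) : ℂ) * μ) x := by
  simpa using (((hasDerivAt_id x).const_mul μ).cos).ofReal_comp

lemma deriv_const_mul_sin (a : ℂ) (μ : ℝ) :
    deriv (fun y : ℝ => a * ((Real.sin (μ * y) : ℝ) : ℂ)) =
      fun x => a * (((Real.cos (μ * x) : ℝ) : ℂ) * μ) :=
  funext fun x => ((hasDerivAt_ofReal_sin_mul μ x).const_mul a).deriv

lemma deriv_deriv_const_mul_sin (a : ℂ) (μ x : ℝ) :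
    deriv (deriv fun y : ℝ => a * ((Real.sin (μ * y) : ℝ) : ℂ)) x =
      -((μ ^ 2 : ℝ) : ℂ) * (a * ((Real.sin (μ * x) : ℝ) : ℂ)) := by
  rw [deriv_const_mul_sin]
  refine (((hasDerivAt_ofReal_cos_mul μ x).mul_const (μ : ℂ)).const_mul a).deriv.trans ?_
  push_cast
  ring

/-- A solution of `f'' = -μ² f` that vanishes at `0` is a multiple of `sin(μ x)`. -/
lemma eq_const_mul_sin_of_deriv_deriv_eq {f : ℝ → ℂ} {μ : ℝ} (hμ : μ ≠ 0)
    (hf : ContDiff ℝ 2 f) (hode : ∀ x, deriv (deriv f) x = -((μ ^ 2 : ℝ) : ℂ) * f x)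
    (h0 : f 0 = 0) (x : ℝ) :
    f x = deriv f 0 / μ * ((Real.sin (μ * x) : ℝ) : ℂ) := by
  have hd : ∀ y, HasDerivAt f (deriv f y) y := fun y =>
    (hf.differentiable (by norm_num) y).hasDerivAt
  have hdd : ∀ y, HasDerivAt (deriv f) (-((μ ^ 2 : ℝ) : ℂ) * f y) y := fun y => by
    rw [← hode y]
    exact ((hf.deriv' (n := 1)).differentiable (by norm_num) y).hasDerivAt
  let A : ℝ → ℂ := fun y => μ * f y * ((Real.cos (μ * y) : ℝ) : ℂ) -
    deriv f y * ((Real.sin (μ * y) : ℝ) : ℂ)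
  let B : ℝ → ℂ := fun y => μ * f y * ((Real.sin (μ * y) : ℝ) : ℂ) +
    deriv f y * ((Real.cos (μ * y) : ℝ) : ℂ)
  have hA : ∀ y, HasDerivAt A 0 y := fun y => by
    refine ((((hd y).const_mul (μ : ℂ)).mul (hasDerivAt_ofReal_cos_mul μ y)).sub
      ((hdd y).mul (hasDerivAt_ofReal_sin_mul μ y))).congr_deriv ?_
    push_cast
    ring
  have hB : ∀ y, HasDerivAt B 0 y := fun y => by
    refine ((((hd y).const_mul (μ : ℂ)).mul (hasDerivAt_ofReal_sin_mul μ y)).add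
      ((hdd y).mul (hasDerivAt_ofReal_cos_mul μ y))).congr_deriv ?_
    push_cast
    ring
  have hAx : A x = A 0 := is_const_of_deriv_eq_zero
    (fun y => (hA y).differentiableAt) (fun y => (hA y).deriv) x 0
  have hBx : B x = B 0 := is_const_of_deriv_eq_zero
    (fun y => (hB y).differentiableAt) (fun y => (hB y).deriv) x 0
  have hμ' : (μ : ℂ) ≠ 0 := Complex.ofReal_ne_zero.mpr hμ
  have htrig : ((Real.sin (μ * x) : ℝ) : ℂ) ^ 2 + ((Real.cos (μ * x) : ℝ) : ℂ) ^ 2 = 1 := by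
    exact_mod_cast Real.sin_sq_add_cos_sq (μ * x)
  simp only [A, B, h0, mul_zero, Real.sin_zero, Real.cos_zero, Complex.ofReal_zero,
    Complex.ofReal_one, sub_zero, zero_add, mul_one] at hAx hBx
  rw [div_mul_eq_mul_div, eq_div_iff hμ']
  linear_combination ((Real.cos (μ * x) : ℝ) : ℂ) * hAx +
    ((Real.sin (μ * x) : ℝ) : ℂ) * hBx - μ * f x * htrig

lemma sinePair_injective {μ : ℝ} (hμ : μ ≠ 0) :
    Function.Injective (sinePair μ : (E → ℂ) → (E → ℝ → ℂ) × (V → ℂ)) := by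
  intro η ξ h
  funext e
  have h' := congrFun (congrFun (congrArg Prod.fst h) e) (Real.pi / 2 / μ)
  simpa only [sinePair, mul_div_cancel₀ _ hμ, Real.sin_pi_div_two, Complex.ofReal_one,
    mul_one] using h'

/-- An eigenfunction with zero vertex values is a multiple of a sine on every edge. -/
lemma exists_sinePair_eq [Fintype E] [DecidableEq V] {s t : E → V} {bd : Finset V}
    {μ : ℝ} (hμ : μ ≠ 0) {p : (E → ℝ → ℂ) × (V → ℂ)}
    (hp : p ∈ metricEigenspace s t bd (μ ^ 2)) (h0 : p.2 = 0) :
    ∃ η : E → ℂ, sinePair μ η = p := by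
  obtain ⟨hC, hode, hs, -⟩ := hp
  refine ⟨fun e => deriv (p.1 e) 0 / μ, Prod.ext ?_ h0.symm⟩
  funext e x
  exact (eq_const_mul_sin_of_deriv_deriv_eq hμ (hC e) (hode e)
    (by rw [hs e, h0]; rfl) x).symm

lemma sinePair_mem_metricEigenspace_iff [Fintype E] [DecidableEq V] {s t : E → V}
    {bd : Finset V} {n : ℕ} (hn : n ≠ 0) (η : E → ℂ) :
    sinePair (n * Real.pi) η ∈ metricEigenspace s t bd ((n * Real.pi) ^ 2) ↔
      ∀ v, v ∉ bd → (∑ e ∈ univ.filter fun e => s e = v, η e) =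
        (-1) ^ n * ∑ e ∈ univ.filter fun e => t e = v, η e := by
  have hμ : (((n * Real.pi : ℝ)) : ℂ) ≠ 0 := Complex.ofReal_ne_zero.mpr
    (mul_ne_zero (Nat.cast_ne_zero.mpr hn) Real.pi_ne_zero)
  have hkirchhoff : ∀ v,
      ((∑ e ∈ univ.filter fun e => s e = v,
          deriv ((sinePair (V := V) (n * Real.pi) η).1 e) 0) =
        ∑ e ∈ univ.filter fun e => t e = v,
          deriv ((sinePair (V := V) (n * Real.pi) η).1 e) 1) ↔
      (∑ e ∈ univ.filter fun e => s e = v, η e) =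
        (-1) ^ n * ∑ e ∈ univ.filter fun e => t e = v, η e := by
    intro v
    simp only [sinePair, deriv_const_mul_sin, mul_zero, mul_one, Real.cos_zero,
      Real.cos_nat_mul_pi, Complex.ofReal_one, one_mul, ← mul_assoc, ← Finset.sum_mul]
    rw [mul_left_inj' hμ]
    push_cast
    rw [mul_comm ((-1 : ℂ) ^ n)]
  refine ⟨fun h v hv => (hkirchhoff v).mp (h.2.2.2.2.2 v hv), fun h => ⟨fun e => ?_,
    fun e x => deriv_deriv_const_mul_sin (η e) _ x, fun e => ?_, fun e => ?_, fun _ _ => rfl,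
    fun v hv => (hkirchhoff v).mpr (h v hv)⟩⟩
  · exact contDiff_const.mul (Complex.ofRealCLM.contDiff.comp
      (Real.contDiff_sin.comp (contDiff_const.mul contDiff_id)))
  · simp [sinePair]
  · simp only [sinePair, mul_one, Real.sin_nat_mul_pi, Complex.ofReal_zero, mul_zero,
      Pi.zero_apply]

/-- **Topological (edge-based) eigenfunctions and relative homology.**
The map `Ψ_n : η ↦ (η_e sin(nπ·), 0)` is a linear isomorphism from the relative
first homology `H_1(X,∂V)` (oriented for `n` even, unoriented for `n` odd) onto
the space `N₀^{∂V}(n²π²)` of metric eigenfunctions vanishing at all vertices. -/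
theorem topological_eigenfunctions_isomorphism
    [Fintype V] [Fintype E] [DecidableEq V] [Nonempty V] [Nonempty E]
    (s t : E → V)
    (hconn : ∀ v w : V, Relation.EqvGen (fun a b => ∃ e, s e = a ∧ t e = b) v w)
    (hend : ∀ v : V, ∃ e : E, s e = v ∨ t e = v)
    (bd : Finset V) (n : ℕ) (hn : 1 ≤ n) :
    letI lamn : ℝ := (n : ℝ) ^ 2 * Real.pi ^ 2
    letI Ψ : (E → ℂ) → (E → ℝ → ℂ) × (V → ℂ) := fun η =>
      (fun e x => η e * ((Real.sin ((n : ℝ) * Real.pi * x) : ℝ) : ℂ), 0)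
    letI H1 : Set (E → ℂ) := {η | ∀ v, v ∉ bd →
      (∑ e ∈ univ.filter fun e => t e = v, η e) =
        ∑ e ∈ univ.filter fun e => s e = v, η e}
    letI H1unor : Set (E → ℂ) := {η | ∀ v, v ∉ bd →
      (∑ e ∈ univ.filter fun e => t e = v, η e) +
        (∑ e ∈ univ.filter fun e => s e = v, η e) = 0}
    (∀ η ξ : E → ℂ, Ψ (η + ξ) = Ψ η + Ψ ξ) ∧
    (∀ (c : ℂ) (η : E → ℂ), Ψ (c • η) = c • Ψ η) ∧
    (Even n →
      (∀ η ∈ H1, Ψ η ∈ metricEigenspace s t bd lamn) ∧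
      (∀ η ∈ H1, ∀ ξ ∈ H1, Ψ η = Ψ ξ → η = ξ) ∧
      (∀ p ∈ metricEigenspace s t bd lamn, p.2 = 0 → ∃ η ∈ H1, Ψ η = p)) ∧
    (Odd n →
      (∀ η ∈ H1unor, Ψ η ∈ metricEigenspace s t bd lamn) ∧
      (∀ η ∈ H1unor, ∀ ξ ∈ H1unor, Ψ η = Ψ ξ → η = ξ) ∧
      (∀ p ∈ metricEigenspace s t bd lamn, p.2 = 0 → ∃ η ∈ H1unor, Ψ η = p)) := by
  have hn0 : n ≠ 0 := Nat.one_le_iff_ne_zero.mp hn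
  have hμ : (n : ℝ) * Real.pi ≠ 0 := mul_ne_zero (Nat.cast_ne_zero.mpr hn0) Real.pi_ne_zero
  have hmem := sinePair_mem_metricEigenspace_iff (s := s) (t := t) (bd := bd) hn0
  rw [← mul_pow]
  refine ⟨fun η ξ => ?_, fun c η => ?_, fun he => ?_, fun ho => ?_⟩
  · exact Prod.ext (by funext e x; exact add_mul _ _ _) (add_zero _).symm
  · exact Prod.ext (by funext e x; exact mul_assoc _ _ _) (smul_zero _).symm
  · simp only [he.neg_one_pow, one_mul] at hmem
    refine ⟨fun η hη => (hmem η).mpr fun v hv => (hη v hv).symm,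
      fun η _ ξ _ h => sinePair_injective (V := V) hμ h, fun p hp h0 => ?_⟩
    obtain ⟨η, rfl⟩ := exists_sinePair_eq hμ hp h0
    exact ⟨η, fun v hv => ((hmem η).mp hp v hv).symm, rfl⟩
  · simp only [ho.neg_one_pow, neg_one_mul] at hmem
    refine ⟨fun η hη => (hmem η).mpr fun v hv => eq_neg_of_add_eq_zero_right (hη v hv),
      fun η _ ξ _ h => sinePair_injective (V := V) hμ h, fun p hp h0 => ?_⟩
    obtain ⟨η, rfl⟩ := exists_sinePair_eq hμ hp h0
    refine ⟨η, fun v hv => ?_, rfl⟩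
    rw [(hmem η).mp hp v hv, add_neg_cancel]
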